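/- For every α > 48 there are a constant c > 0 depending only on α and an absolute constant d0 ≥ 3 such that, with tuning constants α and β = (16/9)(√12 + 2√α)², for all d ≥ d0 and all σ > 0: max over integers s with 1 ≤ s ≤ √(d log d/2) of sup_{θ ∈ Θ_s} P_θ( ŝ' > s ) ≤ c d^{-5}. -/

import Mathlib

open MeasureTheory ProbabilityTheory

/-- Law of `y = θ + σ·ξ` with `ξ` i.i.d. standard normal: the product of Gaussians `N(θ j, σ²)`. -/
noncomputable def gaussMeasure (d : ℕ) (θ : Fin d → ℝ) (σ : ℝ) : Measure (Fin d → ℝ) :=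
  Measure.pi fun j => gaussianReal (θ j) (Real.toNNReal (σ ^ 2))

/-- The sparsity class `Θ_s`: vectors with at most `s` nonzero coordinates. -/
def Theta (d s : ℕ) : Set (Fin d → ℝ) := {θ | {j | θ j ≠ 0}.ncard ≤ s}

/-- The linear functional `L(θ) = ∑ θ_j`. -/
noncomputable def Lfun (d : ℕ) (θ : Fin d → ℝ) : ℝ := ∑ j, θ j

/-- The rate `Φ^L(σ, s) = σ² s² log(1 + d (log d) / s²)`. -/
noncomputable def PhiL (d : ℕ) (σ : ℝ) (s : ℕ) : ℝ :=
  σ ^ 2 * (s : ℝ) ^ 2 * Real.log (1 + (d : ℝ) * Real.log d / (s : ℝ) ^ 2)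

/-- The variance estimator `σ̂ = 9 (⌊d/2⌋⁻¹ ∑_{j ≤ d/2} y_(j)²)^{1/2}`, where the sum of the
`⌊d/2⌋` smallest among `y_1², …, y_d²` is expressed as the minimum over all subsets `G` of
cardinality `⌊d/2⌋` of `∑_{i ∈ G} y_i²`. -/
noncomputable def sigmahat (d : ℕ) (y : Fin d → ℝ) : ℝ :=
  9 * Real.sqrt (((d / 2 : ℕ) : ℝ)⁻¹ *
    sInf {x : ℝ | ∃ G : Finset (Fin d), G.card = d / 2 ∧ x = ∑ i ∈ G, (y i) ^ 2})

/-- The non-adaptive estimators `L̂'_s` (unknown `σ`, plug-in `σ̂`). -/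
noncomputable def LhatS' (d : ℕ) (α : ℝ) (s : ℕ) (y : Fin d → ℝ) : ℝ :=
  if (s : ℝ) ≤ Real.sqrt ((d : ℝ) * Real.log d / 2) then
    ∑ j, if α * (sigmahat d y) ^ 2 * Real.log (1 + (d : ℝ) * Real.log d / (s : ℝ) ^ 2) < (y j) ^ 2
      then y j else 0
  else ∑ j, y j

/-- The random threshold `ω'_s` with `(ω'_s)² = β σ̂² s² log(1 + d (log d)/s²)`. -/
noncomputable def omegaS' (d : ℕ) (β : ℝ) (s : ℕ) (y : Fin d → ℝ) : ℝ :=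
  Real.sqrt (β * (sigmahat d y) ^ 2 * (s : ℝ) ^ 2 *
    Real.log (1 + (d : ℝ) * Real.log d / (s : ℝ) ^ 2))

/-- The selected index `ŝ'`, with the convention `ŝ' = ⌊√(d log d / 2)⌋ + 1` when no index is
admissible. -/
noncomputable def shat' (d : ℕ) (α β : ℝ) (y : Fin d → ℝ) : ℕ :=
  sInf ({s : ℕ | 1 ≤ s ∧ s ≤ Nat.floor (Real.sqrt ((d : ℝ) * Real.log d / 2)) ∧
      ∀ s' : ℕ, s < s' → s' ≤ d → |LhatS' d α s y - LhatS' d α s' y| ≤ omegaS' d β s' y}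
    ∪ {Nat.floor (Real.sqrt ((d : ℝ) * Real.log d / 2)) + 1})

/-- The adaptive estimator `L̂' = L̂'_{ŝ'}` (adaptive to both `s` and `σ`). -/
noncomputable def LhatAdapt' (d : ℕ) (α β : ℝ) (y : Fin d → ℝ) : ℝ :=
  LhatS' d α (shat' d α β y) y


lemma aux_var_ne {σ : ℝ} (hσ : 0 < σ) : Real.toNNReal (σ ^ 2) ≠ 0 := by
  have : 0 < σ ^ 2 := by positivity
  simpa using this.ne'

lemma aux_gauss_exp {σ : ℝ} (hσ : 0 < σ) :
    ∫⁻ x, ENNReal.ofReal (Real.exp (3 * x ^ 2 / (8 * σ ^ 2)))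
      ∂(gaussianReal 0 (Real.toNNReal (σ ^ 2))) = 2 := by
  have hv := aux_var_ne hσ
  have hv4 : Real.toNNReal ((2 * σ) ^ 2) ≠ 0 := aux_var_ne (by positivity)
  rw [gaussianReal_of_var_ne_zero _ hv,
    lintegral_withDensity_eq_lintegral_mul _ (measurable_gaussianPDF _ _) (by fun_prop)]
  have : ∀ x : ℝ, (gaussianPDF 0 (Real.toNNReal (σ ^ 2)) *
      fun x => ENNReal.ofReal (Real.exp (3 * x ^ 2 / (8 * σ ^ 2)))) x
      = 2 * gaussianPDF 0 (Real.toNNReal ((2 * σ) ^ 2)) x := by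
    intro x
    have h2 : (2 : ENNReal) = ENNReal.ofReal 2 := by simp
    rw [Pi.mul_apply, gaussianPDF, gaussianPDF, h2, ← ENNReal.ofReal_mul (gaussianPDFReal_nonneg _ _ _),
      ← ENNReal.ofReal_mul (by norm_num)]
    congr 1
    rw [gaussianPDFReal, gaussianPDFReal, Real.coe_toNNReal _ (by positivity),
      Real.coe_toNNReal _ (by positivity), mul_assoc, ← Real.exp_add]
    have e1 : √(2 * Real.pi * (2 * σ) ^ 2) = 2 * √(2 * Real.pi * σ ^ 2) := by
      rw [show 2 * Real.pi * (2 * σ) ^ 2 = 2 ^ 2 * (2 * Real.pi * σ ^ 2) by ring,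
        Real.sqrt_mul (by norm_num), Real.sqrt_sq (by norm_num)]
    have e2 : -(x - 0) ^ 2 / (2 * σ ^ 2) + 3 * x ^ 2 / (8 * σ ^ 2)
        = -(x - 0) ^ 2 / (2 * (2 * σ) ^ 2) := by
      field_simp; ring
    rw [e1, e2, mul_inv]; ring
  simp_rw [this]
  rw [lintegral_const_mul _ (measurable_gaussianPDF _ _), lintegral_gaussianPDF_eq_one _ hv4, mul_one]

lemma aux_gauss_small {σ : ℝ} (hσ : 0 < σ) :
    gaussianReal 0 (Real.toNNReal (σ ^ 2)) {x | x ^ 2 < 4 * σ ^ 2 / 81} ≤ ENNReal.ofReal (1 / 4) := by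
  have hv := aux_var_ne hσ
  rw [gaussianReal_apply _ hv]
  have hs : {x : ℝ | x ^ 2 < 4 * σ ^ 2 / 81} ⊆ Set.Ioo (-(2 * σ / 9)) (2 * σ / 9) := by
    intro x hx
    have hx' : x ^ 2 < (2 * σ / 9) ^ 2 := by
      have : x ^ 2 < 4 * σ ^ 2 / 81 := hx
      nlinarith
    exact abs_lt.mp (abs_lt_of_sq_lt_sq hx' (by positivity))
  have hpdf : ∀ x, gaussianPDF 0 (Real.toNNReal (σ ^ 2)) x ≤ ENNReal.ofReal (9 / (16 * σ)) := by
    intro x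
    rw [gaussianPDF]
    apply ENNReal.ofReal_le_ofReal
    rw [gaussianPDFReal, Real.coe_toNNReal _ (by positivity)]
    have h1 : Real.exp (-(x - 0) ^ 2 / (2 * σ ^ 2)) ≤ 1 := by
      rw [Real.exp_le_one_iff]
      apply div_nonpos_of_nonpos_of_nonneg <;> nlinarith [sq_nonneg (x - 0), sq_nonneg σ]
    have h2 : 16 * σ / 9 ≤ √(2 * Real.pi * σ ^ 2) := by
      apply Real.le_sqrt_of_sq_le
      have := Real.pi_gt_three
      nlinarith [sq_nonneg σ, mul_pos hσ hσ, mul_pos (mul_pos hσ hσ) (sub_pos.mpr this)]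
    calc (√(2 * Real.pi * σ ^ 2))⁻¹ * Real.exp (-(x - 0) ^ 2 / (2 * σ ^ 2))
        ≤ (16 * σ / 9)⁻¹ * 1 := by gcongr
      _ = 9 / (16 * σ) := by rw [mul_one, inv_div]
  calc ∫⁻ x in {x : ℝ | x ^ 2 < 4 * σ ^ 2 / 81}, gaussianPDF 0 (Real.toNNReal (σ ^ 2)) x
      ≤ ∫⁻ x in {x : ℝ | x ^ 2 < 4 * σ ^ 2 / 81}, ENNReal.ofReal (9 / (16 * σ)) :=
        lintegral_mono hpdf
    _ = ENNReal.ofReal (9 / (16 * σ)) * volume {x : ℝ | x ^ 2 < 4 * σ ^ 2 / 81} := by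
        rw [setLIntegral_const]
    _ ≤ ENNReal.ofReal (9 / (16 * σ)) * volume (Set.Ioo (-(2 * σ / 9)) (2 * σ / 9)) := by
        gcongr
    _ = ENNReal.ofReal (1 / 4) := by
        rw [Real.volume_Ioo, ← ENNReal.ofReal_mul (by positivity)]
        congr 1; field_simp; ring

lemma aux_pi_prod {d : ℕ} (θ : Fin d → ℝ) (σ : ℝ) (f : Fin d → ℝ → ENNReal)
    (hf : ∀ j, Measurable (f j)) :
    ∫⁻ y, ∏ j, f j (y j) ∂(gaussMeasure d θ σ)
      = ∏ j, ∫⁻ x, f j x ∂(gaussianReal (θ j) (Real.toNNReal (σ ^ 2))) := by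
  have hind : iIndepFun (fun (j : Fin d) (y : Fin d → ℝ) => f j (y j)) (gaussMeasure d θ σ) :=
    iIndepFun_pi (fun j => (hf j).aemeasurable)
  have := lintegral_prod_eq_prod_lintegral_of_indepFun Finset.univ
    (fun (j : Fin d) (y : Fin d → ℝ) => f j (y j)) hind (fun j => (hf j).comp (measurable_pi_apply j))
  rw [this]
  refine Finset.prod_congr rfl fun j _ => ?_
  have hmp : MeasurePreserving (Function.eval j) (gaussMeasure d θ σ)
      (gaussianReal (θ j) (Real.toNNReal (σ ^ 2))) := measurePreserving_eval _ j
  exact hmp.lintegral_comp (hf j)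

lemma aux_chernoff {d : ℕ} {θ : Fin d → ℝ} (σ : ℝ) (S : Finset (Fin d))
    (hS : ∀ j, j ∉ S → θ j = 0) (f : ℝ → ENNReal) (hf : Measurable f) (K : ENNReal) (hK : 1 ≤ K)
    (hfK : ∫⁻ x, f x ∂(gaussianReal 0 (Real.toNNReal (σ ^ 2))) ≤ K) :
    ∫⁻ y, ∏ j, (if j ∈ S then 1 else f (y j)) ∂(gaussMeasure d θ σ) ≤ K ^ d := by
  have h := aux_pi_prod θ σ (fun j x => if j ∈ S then 1 else f x)
    (fun j => by by_cases hj : j ∈ S <;> simp [hj, hf])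
  rw [h]
  calc _ ≤ ∏ j : Fin d, K := by
        refine Finset.prod_le_prod' fun j _ => ?_
        by_cases hj : j ∈ S
        · simpa [hj] using hK
        · simpa [hj, hS j hj] using hfK
    _ = K ^ d := by simp

/-- Markov with a deterministic lower bound. -/
lemma aux_markov {Ω : Type*} [MeasurableSpace Ω] (μ : Measure Ω) (F : Ω → ENNReal)
    (A : Set Ω) (a b : ℝ) (ha : 0 < a)
    (hA : ∀ y ∈ A, ENNReal.ofReal a ≤ F y) (hI : ∫⁻ y, F y ∂μ ≤ ENNReal.ofReal b) (hF : Measurable F) :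
    μ A ≤ ENNReal.ofReal (b / a) := by
  have h1 : μ A ≤ μ {y | ENNReal.ofReal a ≤ F y} := measure_mono hA
  have h2 := meas_ge_le_lintegral_div (μ := μ) hF.aemeasurable (ε := ENNReal.ofReal a)
    (by simpa using ha) (by simp)
  refine h1.trans (h2.trans ?_)
  rw [ENNReal.ofReal_div_of_pos ha]
  gcongr

lemma aux_flip_mp {d : ℕ} {θ : Fin d → ℝ} (σ : ℝ) (S : Finset (Fin d))
    (hS : ∀ j, j ∉ S → θ j = 0) (ε : Fin d → Bool) :
    MeasurePreserving (fun (y : Fin d → ℝ) j => if j ∈ S then y j else (if ε j then y j else - y j))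
      (gaussMeasure d θ σ) (gaussMeasure d θ σ) := by
  unfold gaussMeasure
  refine measurePreserving_pi _ _
    (f := fun j (x : ℝ) => if j ∈ S then x else (if ε j then x else - x)) fun j => ?_
  by_cases hj : j ∈ S
  · simp only [hj, if_true]; exact MeasurePreserving.id _
  · by_cases he : ε j
    · simp only [hj, he, if_true, if_false]; exact MeasurePreserving.id _
    · simp only [hj, he, if_false, Bool.false_eq_true]
      refine ⟨measurable_neg, ?_⟩
      rw [hS j hj]
      have := gaussianReal_map_neg (μ := 0) (v := Real.toNNReal (σ ^ 2))
      rw [neg_zero] at this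
      exact this

lemma aux_sym {d : ℕ} {θ : Fin d → ℝ} (σ : ℝ) (S : Finset (Fin d))
    (hS : ∀ j, j ∉ S → θ j = 0) (w : (Fin d → ℝ) → Fin d → ℝ)
    (hw : ∀ j, Measurable fun y => w y j)
    (hinv : ∀ y y' : Fin d → ℝ, (∀ j, y j ^ 2 = y' j ^ 2) → w y = w y') (l : ℝ) :
    ∫⁻ y, ∏ j, (if j ∈ S then 1 else
        ENNReal.ofReal (Real.exp (l * (w y j * y j) - l ^ 2 * (w y j * y j) ^ 2 / 2)))
      ∂(gaussMeasure d θ σ) ≤ 1 := by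
  set μ := gaussMeasure d θ σ with hμ
  have : IsProbabilityMeasure μ := by rw [hμ]; unfold gaussMeasure; infer_instance
  set F : (Fin d → ℝ) → ENNReal := fun y => ∏ j, (if j ∈ S then 1 else
        ENNReal.ofReal (Real.exp (l * (w y j * y j) - l ^ 2 * (w y j * y j) ^ 2 / 2))) with hF
  have hFm : Measurable F := by
    rw [hF]
    refine Finset.measurable_fun_prod _ fun j _ => ?_
    by_cases hj : j ∈ S
    · simp [hj]
    · simp only [hj, if_false]
      have := hw j
      fun_prop
  set fl : (Fin d → Bool) → (Fin d → ℝ) → (Fin d → ℝ) :=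
    fun ε y j => if j ∈ S then y j else (if ε j then y j else - y j) with hfl
  have hmp : ∀ ε, MeasurePreserving (fl ε) μ μ := fun ε => aux_flip_mp σ S hS ε
  have h1 : ∀ ε, ∫⁻ y, F (fl ε y) ∂μ = ∫⁻ y, F y ∂μ := fun ε => (hmp ε).lintegral_comp hFm
  have h2 : ∑ ε : Fin d → Bool, ∫⁻ y, F (fl ε y) ∂μ = 2 ^ d * ∫⁻ y, F y ∂μ := by
    simp_rw [h1]; simp
  have h3 : ∑ ε : Fin d → Bool, ∫⁻ y, F (fl ε y) ∂μ ≤ 2 ^ d := by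
    have hsw : ∑ ε : Fin d → Bool, ∫⁻ y, F (fl ε y) ∂μ = ∫⁻ y, ∑ ε : Fin d → Bool, F (fl ε y) ∂μ :=
      (lintegral_finsetSum _ fun ε _ => hFm.comp (hmp ε).measurable).symm
    rw [hsw]
    have hpt : ∀ y, ∑ ε : Fin d → Bool, F (fl ε y) ≤ 2 ^ d := by
      intro y
      have e1 : ∀ ε, F (fl ε y) = ∏ j, (fun j (b : Bool) => if j ∈ S then (1 : ENNReal) else
          ENNReal.ofReal (Real.exp (l * (w y j * (if b then y j else - y j))
            - l ^ 2 * (w y j * y j) ^ 2 / 2))) j (ε j) := by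
        intro ε
        have hwe : w (fl ε y) = w y := by
          apply hinv
          intro j
          simp only [hfl]
          split_ifs <;> ring
        simp only [hF, hwe]
        refine Finset.prod_congr rfl fun j _ => ?_
        by_cases hj : j ∈ S
        · simp [hj]
        · by_cases hb : ε j
          · simp [hj, hfl, hb]
          · simp [hj, hfl, hb]
      simp_rw [e1]
      have e2 := Finset.prod_univ_sum (fun _ : Fin d => (Finset.univ : Finset Bool))
        (fun j (b : Bool) => if j ∈ S then (1 : ENNReal) else
          ENNReal.ofReal (Real.exp (l * (w y j * (if b then y j else - y j))
            - l ^ 2 * (w y j * y j) ^ 2 / 2)))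
      rw [Fintype.piFinset_univ] at e2
      rw [← e2]
      calc _ ≤ ∏ j : Fin d, (2 : ENNReal) := by
            refine Finset.prod_le_prod' fun j _ => ?_
            by_cases hj : j ∈ S
            · simp [hj]
            · simp only [hj, if_false, Fintype.sum_bool, if_true, Bool.false_eq_true]
              rw [← ENNReal.ofReal_add (by positivity) (by positivity)]
              rw [show (2 : ENNReal) = ENNReal.ofReal 2 by simp]
              apply ENNReal.ofReal_le_ofReal
              set a := w y j * y j with ha
              have hc := Real.cosh_le_exp_half_sq (l * a)
              rw [Real.cosh_eq] at hc
              rw [show w y j * -y j = - a by rw [ha]; ring]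
              rw [sub_eq_add_neg, sub_eq_add_neg, Real.exp_add, Real.exp_add, ← add_mul, Real.exp_neg,
                ← div_eq_mul_inv, div_le_iff₀ (Real.exp_pos _)]
              rw [show l ^ 2 * a ^ 2 / 2 = (l * a) ^ 2 / 2 by ring, show l * -a = -(l * a) by ring]
              linarith
        _ = 2 ^ d := by simp
    calc _ ≤ ∫⁻ y, (2 : ENNReal) ^ d ∂μ := lintegral_mono hpt
      _ = 2 ^ d := by simp
  rw [h2] at h3
  have h4 : (2 : ENNReal) ^ d * ∫⁻ y, F y ∂μ ≤ 2 ^ d * 1 := by simpa using h3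
  exact (ENNReal.mul_le_mul_iff_right (by positivity) (by simp)).mp h4

lemma aux_hoeff_one {d : ℕ} {θ : Fin d → ℝ} (σ : ℝ) (S : Finset (Fin d))
    (hS : ∀ j, j ∉ S → θ j = 0) (w : (Fin d → ℝ) → Fin d → ℝ)
    (hw : ∀ j, Measurable fun y => w y j)
    (hinv : ∀ y y' : Fin d → ℝ, (∀ j, y j ^ 2 = y' j ^ 2) → w y = w y')
    (u v r : ℝ) (hv : 0 < v) (hr : r ^ 2 = 1) (hu : 0 ≤ u) :
    gaussMeasure d θ σ {y | u < r * ∑ j ∈ Sᶜ, w y j * y j ∧ ∑ j ∈ Sᶜ, (w y j * y j) ^ 2 ≤ v}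
      ≤ ENNReal.ofReal (Real.exp (- (u ^ 2 / (2 * v)))) := by
  set l := r * u / v with hl
  have hs := aux_sym σ S hS w hw hinv l
  have := aux_markov (gaussMeasure d θ σ) _
    {y | u < r * ∑ j ∈ Sᶜ, w y j * y j ∧ ∑ j ∈ Sᶜ, (w y j * y j) ^ 2 ≤ v}
    (Real.exp (u ^ 2 / (2 * v))) 1 (Real.exp_pos _) ?_ (by simpa using hs) ?_
  · rwa [one_div, ← Real.exp_neg] at this
  · rintro y ⟨h1, h2⟩
    have e : ∏ j, (if j ∈ S then (1 : ENNReal) else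
        ENNReal.ofReal (Real.exp (l * (w y j * y j) - l ^ 2 * (w y j * y j) ^ 2 / 2)))
        = ENNReal.ofReal (Real.exp (l * ∑ j ∈ Sᶜ, w y j * y j
            - l ^ 2 * (∑ j ∈ Sᶜ, (w y j * y j) ^ 2) / 2)) := by
      rw [← Finset.prod_mul_prod_compl S]
      rw [Finset.prod_congr rfl (g := fun _ => (1 : ENNReal)) (fun j hj => by simp [hj])]
      rw [Finset.prod_congr (s₁ := Sᶜ) rfl (g := fun j => ENNReal.ofReal
        (Real.exp (l * (w y j * y j) - l ^ 2 * (w y j * y j) ^ 2 / 2)))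
        (fun j hj => by rw [if_neg (Finset.mem_compl.mp hj)])]
      rw [Finset.prod_const_one, one_mul, ← ENNReal.ofReal_prod_of_nonneg (fun _ _ => by positivity),
        ← Real.exp_sum, Finset.sum_sub_distrib, Finset.mul_sum, Finset.mul_sum, Finset.sum_div]
    rw [e]
    apply ENNReal.ofReal_le_ofReal
    apply Real.exp_le_exp.mpr
    set T := ∑ j ∈ Sᶜ, w y j * y j
    set V := ∑ j ∈ Sᶜ, (w y j * y j) ^ 2
    have e1 : l * T = u / v * (r * T) := by rw [hl]; ring
    have e2 : l ^ 2 = u ^ 2 / v ^ 2 := by rw [hl, div_pow, mul_pow, hr, one_mul]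
    rw [e1, e2]
    have e3 : u / v * u ≤ u / v * (r * T) := by gcongr
    have e4 : u ^ 2 / v ^ 2 * V / 2 ≤ u ^ 2 / v ^ 2 * v / 2 := by gcongr
    have e5 : u / v * u - u ^ 2 / v ^ 2 * v / 2 = u ^ 2 / (2 * v) := by field_simp; ring
    linarith
  · refine Finset.measurable_fun_prod _ fun j _ => ?_
    by_cases hj : j ∈ S
    · simp [hj]
    · simp only [hj, if_false]
      have := hw j
      fun_prop

lemma aux_hoeff {d : ℕ} {θ : Fin d → ℝ} (σ : ℝ) (S : Finset (Fin d))
    (hS : ∀ j, j ∉ S → θ j = 0) (w : (Fin d → ℝ) → Fin d → ℝ)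
    (hw : ∀ j, Measurable fun y => w y j)
    (hinv : ∀ y y' : Fin d → ℝ, (∀ j, y j ^ 2 = y' j ^ 2) → w y = w y')
    (u v : ℝ) (hv : 0 < v) (hu : 0 ≤ u) :
    gaussMeasure d θ σ {y | u < |∑ j ∈ Sᶜ, w y j * y j| ∧ ∑ j ∈ Sᶜ, (w y j * y j) ^ 2 ≤ v}
      ≤ ENNReal.ofReal (2 * Real.exp (- (u ^ 2 / (2 * v)))) := by
  have h1 := aux_hoeff_one σ S hS w hw hinv u v 1 hv (by norm_num) hu
  have h2 := aux_hoeff_one σ S hS w hw hinv u v (-1) hv (by norm_num) hu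
  rw [two_mul, ENNReal.ofReal_add (by positivity) (by positivity)]
  refine le_trans (le_trans (measure_mono ?_) (measure_union_le _ _)) (add_le_add h1 h2)
  rintro y ⟨h, h'⟩
  rcases lt_abs.mp h with h | h
  · left; exact ⟨by linarith, h'⟩
  · right; exact ⟨by linarith, h'⟩

lemma aux_sigmahat_meas (d : ℕ) : Measurable (sigmahat d) := by
  have : sigmahat d = fun y => 9 * Real.sqrt (((d / 2 : ℕ) : ℝ)⁻¹ *
      ⨅ G : {G : Finset (Fin d) // G.card = d / 2}, ∑ i ∈ G.1, (y i) ^ 2) := by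
    funext y
    unfold sigmahat
    congr 4
    ext x
    constructor
    · rintro ⟨G, hG, rfl⟩; exact ⟨⟨G, hG⟩, rfl⟩
    · rintro ⟨⟨G, hG⟩, rfl⟩; exact ⟨G, hG, rfl⟩
  rw [this]
  have h : Measurable fun y : Fin d → ℝ =>
      ⨅ G : {G : Finset (Fin d) // G.card = d / 2}, ∑ i ∈ G.1, (y i) ^ 2 :=
    Measurable.iInf fun G => by fun_prop
  exact ((h.const_mul _).sqrt).const_mul _

lemma aux_sigmahat_inv {d : ℕ} (y y' : Fin d → ℝ) (h : ∀ j, y j ^ 2 = y' j ^ 2) :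
    sigmahat d y = sigmahat d y' := by
  unfold sigmahat; simp_rw [h]

lemma aux_sigmahat_nonneg {d : ℕ} (y : Fin d → ℝ) : 0 ≤ sigmahat d y := by
  unfold sigmahat; positivity

lemma aux_prod_split {d : ℕ} (S : Finset (Fin d)) (g : Fin d → ENNReal) :
    ∏ j, (if j ∈ S then (1 : ENNReal) else g j) = ∏ j ∈ Sᶜ, g j := by
  rw [← Finset.prod_mul_prod_compl S]
  rw [Finset.prod_congr rfl (g := fun _ => (1 : ENNReal)) (fun j hj => by simp [hj])]
  rw [Finset.prod_congr (s₁ := Sᶜ) rfl (g := g)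
    (fun j hj => by rw [if_neg (Finset.mem_compl.mp hj)])]
  rw [Finset.prod_const_one, one_mul]

lemma aux_prod_meas {d : ℕ} (S : Finset (Fin d)) (f : ℝ → ENNReal) (hf : Measurable f) :
    Measurable fun y : Fin d → ℝ => ∏ j, (if j ∈ S then (1 : ENNReal) else f (y j)) := by
  refine Finset.measurable_fun_prod _ fun j _ => ?_
  by_cases hj : j ∈ S
  · simp [hj]
  · simp only [hj, if_false]
    fun_prop

/-- Many small coordinates are unlikely. -/
lemma aux_count {d : ℕ} {θ : Fin d → ℝ} {σ : ℝ} (hσ : 0 < σ) (S : Finset (Fin d))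
    (hS : ∀ j, j ∉ S → θ j = 0) :
    gaussMeasure d θ σ {y | (d : ℝ) / 3 ≤ ((Sᶜ.filter fun j => y j ^ 2 < 4 * σ ^ 2 / 81).card : ℝ)}
      ≤ ENNReal.ofReal ((5 / 4) ^ d / (2 : ℝ) ^ ((d : ℝ) / 3)) := by
  set A : Set ℝ := {x | x ^ 2 < 4 * σ ^ 2 / 81} with hA
  have hAm : MeasurableSet A := measurableSet_lt (by fun_prop) (by fun_prop)
  set f : ℝ → ENNReal := fun x => 1 + A.indicator 1 x with hf
  have hfm : Measurable f := by
    have h1 : Measurable (A.indicator (1 : ℝ → ENNReal)) := measurable_one.indicator hAm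
    rw [hf]; fun_prop
  have hK : ∫⁻ x, f x ∂(gaussianReal 0 (Real.toNNReal (σ ^ 2))) ≤ ENNReal.ofReal (5 / 4) := by
    rw [hf, lintegral_add_left measurable_const, lintegral_indicator_one hAm]
    simp only [lintegral_const, measure_univ, mul_one]
    rw [show (5 / 4 : ℝ) = 1 + 1 / 4 by norm_num, ENNReal.ofReal_add (by norm_num) (by norm_num)]
    simpa using aux_gauss_small hσ
  have hI := aux_chernoff σ S hS f hfm (ENNReal.ofReal (5 / 4))
    (by simpa using ENNReal.ofReal_le_ofReal (show (1 : ℝ) ≤ 5 / 4 by norm_num)) hK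
  rw [← ENNReal.ofReal_pow (by norm_num)] at hI
  refine aux_markov _ _ _ _ _ (by positivity) ?_ hI (aux_prod_meas S f hfm)
  intro y hy
  have hy' : (d : ℝ) / 3 ≤ ((Sᶜ.filter fun j => y j ^ 2 < 4 * σ ^ 2 / 81).card : ℝ) := hy
  rw [aux_prod_split S (fun j => f (y j))]
  have e : ∏ j ∈ Sᶜ, f (y j) = 2 ^ ((Sᶜ.filter fun j => y j ^ 2 < 4 * σ ^ 2 / 81).card) := by
    rw [← Finset.prod_const, Finset.prod_filter]
    refine Finset.prod_congr rfl fun j _ => ?_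
    by_cases h : y j ^ 2 < 4 * σ ^ 2 / 81
    · simp only [hf, hA, Set.indicator, Set.mem_ofPred_eq, h, if_true, Pi.one_apply]; norm_num
    · simp only [hf, hA, Set.indicator, Set.mem_ofPred_eq, h, if_false, add_zero]
  rw [e]
  calc ENNReal.ofReal ((2 : ℝ) ^ ((d : ℝ) / 3))
      ≤ ENNReal.ofReal ((2 : ℝ) ^ ((Sᶜ.filter fun j => y j ^ 2 < 4 * σ ^ 2 / 81).card)) := by
        apply ENNReal.ofReal_le_ofReal
        rw [← Real.rpow_natCast]
        exact Real.rpow_le_rpow_of_exponent_le (by norm_num) hy'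
    _ = _ := by rw [ENNReal.ofReal_pow (by norm_num)]; simp

lemma aux_sigmahat_lt {d : ℕ} {σ : ℝ} (hσ : 0 < σ) (S : Finset (Fin d)) (s : ℕ) (hs : S.card ≤ s)
    (hd : 2 ≤ d) (hsd : (s : ℝ) ≤ d / 24 - 3 / 8) (y : Fin d → ℝ) (hy : sigmahat d y < σ) :
    (d : ℝ) / 3 ≤ ((Sᶜ.filter fun j => y j ^ 2 < 4 * σ ^ 2 / 81).card : ℝ) := by
  set m := d / 2 with hm
  have hm1 : 1 ≤ m := by omega
  have hmd : d ≤ 2 * m + 1 := by omega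
  have hm0 : (0 : ℝ) < m := by exact_mod_cast hm1
  set X : Set ℝ := {x : ℝ | ∃ G : Finset (Fin d), G.card = d / 2 ∧ x = ∑ i ∈ G, (y i) ^ 2} with hX
  have hne : X.Nonempty := by
    obtain ⟨G, -, hG⟩ := Finset.exists_subset_card_eq (s := (Finset.univ : Finset (Fin d))) (n := d / 2)
      (by simp; omega)
    exact ⟨_, G, hG, rfl⟩
  have hX0 : 0 ≤ sInf X := by
    apply Real.sInf_nonneg
    rintro x ⟨G, -, rfl⟩
    positivity
  have h1 : sInf X < m * σ ^ 2 / 81 := by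
    have h2 : 9 * Real.sqrt ((m : ℝ)⁻¹ * sInf X) < σ := hy
    have h3 : Real.sqrt ((m : ℝ)⁻¹ * sInf X) < σ / 9 := by linarith
    rw [Real.sqrt_lt' (by positivity)] at h3
    rw [inv_mul_lt_iff₀ hm0] at h3
    calc _ < _ := h3
      _ = _ := by ring
  obtain ⟨x, ⟨G, hG, rfl⟩, hx⟩ := exists_lt_of_csInf_lt hne h1
  set P : Fin d → Prop := fun j => y j ^ 2 < 4 * σ ^ 2 / 81 with hP
  have h4 : ((G.filter fun j => ¬ P j).card : ℝ) * (4 * σ ^ 2 / 81) ≤ ∑ i ∈ G, (y i) ^ 2 := by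
    calc ((G.filter fun j => ¬ P j).card : ℝ) * (4 * σ ^ 2 / 81)
        = ∑ i ∈ G.filter (fun j => ¬ P j), (4 * σ ^ 2 / 81) := by simp
      _ ≤ ∑ i ∈ G.filter (fun j => ¬ P j), (y i) ^ 2 := by
          refine Finset.sum_le_sum fun i hi => ?_
          exact not_lt.mp (Finset.mem_filter.mp hi).2
      _ ≤ ∑ i ∈ G, (y i) ^ 2 :=
          Finset.sum_le_sum_of_subset_of_nonneg (Finset.filter_subset _ _) (fun _ _ _ => by positivity)
  have h5 : ((G.filter fun j => ¬ P j).card : ℝ) ≤ m / 4 := by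
    have h6 : ((G.filter fun j => ¬ P j).card : ℝ) * (4 * σ ^ 2 / 81) < (m / 4) * (4 * σ ^ 2 / 81) := by
      calc _ < _ := lt_of_le_of_lt h4 hx
        _ = _ := by ring
    exact (lt_of_mul_lt_mul_right h6 (by positivity)).le
  have h7 : (G.filter fun j => P j).card + (G.filter fun j => ¬ P j).card = m := by
    rw [Finset.card_filter_add_card_filter_not, hG]
  have h8 : (G.filter fun j => P j).card ≤ (Sᶜ.filter fun j => P j).card + S.card := by
    refine le_trans (Finset.card_le_card ?_) (Finset.card_union_le _ _)
    intro j hj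
    rw [Finset.mem_union, Finset.mem_filter, Finset.mem_compl]
    by_cases h : j ∈ S
    · right; exact h
    · left; exact ⟨h, (Finset.mem_filter.mp hj).2⟩
  have h7' : ((G.filter fun j => P j).card : ℝ) + ((G.filter fun j => ¬ P j).card : ℝ) = m := by
    exact_mod_cast h7
  have h8' : ((G.filter fun j => P j).card : ℝ) ≤ ((Sᶜ.filter fun j => P j).card : ℝ) + S.card := by
    exact_mod_cast h8
  have hs' : (S.card : ℝ) ≤ s := by exact_mod_cast hs
  have hmd' : (d : ℝ) ≤ 2 * m + 1 := by exact_mod_cast hmd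
  linarith

lemma aux_chi {d : ℕ} {θ : Fin d → ℝ} {σ : ℝ} (hσ : 0 < σ) (S : Finset (Fin d))
    (hS : ∀ j, j ∉ S → θ j = 0) :
    gaussMeasure d θ σ {y | 4 * σ ^ 2 * d < ∑ j ∈ Sᶜ, y j ^ 2}
      ≤ ENNReal.ofReal (2 ^ d / Real.exp (3 / 2 * d)) := by
  have hI := aux_chernoff σ S hS (fun x => ENNReal.ofReal (Real.exp (3 * x ^ 2 / (8 * σ ^ 2))))
    (by fun_prop) (ENNReal.ofReal 2) (by simp) (by simpa using (aux_gauss_exp hσ).le)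
  rw [← ENNReal.ofReal_pow (by norm_num)] at hI
  refine aux_markov _ _ _ _ _ (by positivity) ?_ hI (aux_prod_meas S
    (fun x => ENNReal.ofReal (Real.exp (3 * x ^ 2 / (8 * σ ^ 2)))) (by fun_prop))
  intro y hy
  have hy' : 4 * σ ^ 2 * d < ∑ j ∈ Sᶜ, y j ^ 2 := hy
  rw [aux_prod_split S (fun j => ENNReal.ofReal (Real.exp (3 * y j ^ 2 / (8 * σ ^ 2)))),
    ← ENNReal.ofReal_prod_of_nonneg (fun _ _ => by positivity), ← Real.exp_sum]
  apply ENNReal.ofReal_le_ofReal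
  apply Real.exp_le_exp.mpr
  rw [← Finset.sum_div, ← Finset.mul_sum, le_div_iff₀ (by positivity)]
  nlinarith

lemma aux_tail_pt {σ : ℝ} (hσ : 0 < σ) (L : ℝ) (x : ℝ) (hx : 48 * L * σ ^ 2 < x ^ 2) :
    L ≤ x ^ 2 / (48 * σ ^ 2) := by
  rw [le_div_iff₀ (by positivity)]; nlinarith

/-- Exponential bound for the tail sum of squares. -/
lemma aux_tail {d : ℕ} {θ : Fin d → ℝ} {σ : ℝ} (hσ : 0 < σ) (S : Finset (Fin d))
    (hS : ∀ j, j ∉ S → θ j = 0) (L v : ℝ) :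
    gaussMeasure d θ σ {y | v * σ ^ 2 < ∑ j ∈ Sᶜ, if 48 * L * σ ^ 2 < y j ^ 2 then y j ^ 2 else 0}
      ≤ ENNReal.ofReal (Real.exp (2 * d * Real.exp (-(6 * L)) - v / 4)) := by
  set A : Set ℝ := {x | 48 * L * σ ^ 2 < x ^ 2} with hA
  have hAm : MeasurableSet A := measurableSet_lt (by fun_prop) (by fun_prop)
  set f : ℝ → ENNReal := fun x => ENNReal.ofReal (Real.exp ((if 48 * L * σ ^ 2 < x ^ 2 then x ^ 2 else 0)
    / (4 * σ ^ 2))) with hf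
  have hfm : Measurable f := by
    have : Measurable fun x : ℝ => if 48 * L * σ ^ 2 < x ^ 2 then x ^ 2 else 0 :=
      Measurable.ite hAm (by fun_prop) measurable_const
    rw [hf]; fun_prop
  set k := 2 * Real.exp (-(6 * L)) with hk
  have hk0 : 0 < k := by positivity
  have hK : ∫⁻ x, f x ∂(gaussianReal 0 (Real.toNNReal (σ ^ 2))) ≤ ENNReal.ofReal (1 + k) := by
    have hpt : ∀ x, f x ≤ 1 + ENNReal.ofReal (Real.exp (-(6 * L))) *
        ENNReal.ofReal (Real.exp (3 * x ^ 2 / (8 * σ ^ 2))) := by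
      intro x
      by_cases h : 48 * L * σ ^ 2 < x ^ 2
      · simp only [hf, h, if_true]
        refine le_trans ?_ le_add_self
        rw [← ENNReal.ofReal_mul (by positivity), ← Real.exp_add]
        apply ENNReal.ofReal_le_ofReal
        apply Real.exp_le_exp.mpr
        have := aux_tail_pt hσ L x h
        have e : 3 * x ^ 2 / (8 * σ ^ 2) = x ^ 2 / (4 * σ ^ 2) + 6 * (x ^ 2 / (48 * σ ^ 2)) := by
          field_simp; ring
        rw [e]; linarith
      · simp only [hf, h, if_false, zero_div, Real.exp_zero, ENNReal.ofReal_one]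
        exact le_self_add
    refine (lintegral_mono hpt).trans ?_
    rw [lintegral_add_left measurable_const, lintegral_const_mul _ (by fun_prop), aux_gauss_exp hσ]
    simp only [lintegral_const, measure_univ, mul_one]
    rw [ENNReal.ofReal_add (by norm_num) hk0.le, hk, ENNReal.ofReal_mul (by norm_num), mul_comm]
    simp
  have hI := aux_chernoff σ S hS f hfm (ENNReal.ofReal (1 + k))
    (by simpa using ENNReal.ofReal_le_ofReal (show (1 : ℝ) ≤ 1 + k by linarith)) hK
  rw [← ENNReal.ofReal_pow (by positivity)] at hI
  refine (aux_markov _ _ _ (Real.exp (v / 4)) _ (by positivity) ?_ hI (aux_prod_meas S f hfm)).trans ?_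
  · intro y hy
    have hy' : v * σ ^ 2 < ∑ j ∈ Sᶜ, if 48 * L * σ ^ 2 < y j ^ 2 then y j ^ 2 else 0 := hy
    rw [aux_prod_split S (fun j => f (y j)), hf,
      ← ENNReal.ofReal_prod_of_nonneg (fun _ _ => by positivity), ← Real.exp_sum]
    apply ENNReal.ofReal_le_ofReal
    apply Real.exp_le_exp.mpr
    rw [← Finset.sum_div, le_div_iff₀ (by positivity)]
    linarith
  · apply ENNReal.ofReal_le_ofReal
    rw [Real.exp_sub]
    gcongr
    have h1 : 1 + k ≤ Real.exp k := by linarith [Real.add_one_le_exp k]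
    calc (1 + k) ^ d ≤ (Real.exp k) ^ d := by gcongr
      _ = Real.exp (2 * d * Real.exp (-(6 * L))) := by
        rw [← Real.exp_nat_mul]; congr 1; rw [hk]; ring

/-- Union bound for the tail sum of squares. -/
lemma aux_tail_union {d : ℕ} {θ : Fin d → ℝ} {σ : ℝ} (hσ : 0 < σ) (S : Finset (Fin d))
    (hS : ∀ j, j ∉ S → θ j = 0) (L v : ℝ) (hv : 0 ≤ v) :
    gaussMeasure d θ σ {y | v * σ ^ 2 < ∑ j ∈ Sᶜ, if 48 * L * σ ^ 2 < y j ^ 2 then y j ^ 2 else 0}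
      ≤ ENNReal.ofReal (2 * d * Real.exp (-(18 * L))) := by
  have hone : gaussianReal 0 (Real.toNNReal (σ ^ 2)) {x | 48 * L * σ ^ 2 < x ^ 2}
      ≤ ENNReal.ofReal (2 * Real.exp (-(18 * L))) := by
    refine (aux_markov _ (fun x => ENNReal.ofReal (Real.exp (3 * x ^ 2 / (8 * σ ^ 2))))
      _ (Real.exp (18 * L)) 2 (by positivity) ?_ (by simpa using (aux_gauss_exp hσ).le)
      (by fun_prop)).trans ?_
    · intro x hx
      apply ENNReal.ofReal_le_ofReal
      apply Real.exp_le_exp.mpr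
      have := aux_tail_pt hσ L x hx
      have e : 3 * x ^ 2 / (8 * σ ^ 2) = 18 * (x ^ 2 / (48 * σ ^ 2)) := by
        field_simp; ring
      rw [e]; linarith
    · rw [Real.exp_neg, div_eq_mul_inv]
  have hsub : {y : Fin d → ℝ | v * σ ^ 2 < ∑ j ∈ Sᶜ, if 48 * L * σ ^ 2 < y j ^ 2 then y j ^ 2 else 0}
      ⊆ ⋃ j ∈ Sᶜ, {y : Fin d → ℝ | 48 * L * σ ^ 2 < y j ^ 2} := by
    intro y hy
    by_contra hcon
    simp only [Set.mem_iUnion, Set.mem_ofPred_eq, not_exists] at hcon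
    have h0 : ∑ j ∈ Sᶜ, (if 48 * L * σ ^ 2 < y j ^ 2 then y j ^ 2 else 0) = 0 :=
      Finset.sum_eq_zero fun j hj => by rw [if_neg (hcon j hj)]
    have hy' : v * σ ^ 2 < ∑ j ∈ Sᶜ, if 48 * L * σ ^ 2 < y j ^ 2 then y j ^ 2 else 0 := hy
    rw [h0] at hy'
    have : 0 ≤ v * σ ^ 2 := by positivity
    linarith
  refine (measure_mono hsub).trans ((measure_biUnion_finset_le _ _).trans ?_)
  calc ∑ j ∈ Sᶜ, gaussMeasure d θ σ {y : Fin d → ℝ | 48 * L * σ ^ 2 < y j ^ 2}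
      ≤ ∑ j ∈ Sᶜ, ENNReal.ofReal (2 * Real.exp (-(18 * L))) := by
        refine Finset.sum_le_sum fun j hj => ?_
        have hmp : MeasurePreserving (Function.eval j) (gaussMeasure d θ σ)
          (gaussianReal (θ j) (Real.toNNReal (σ ^ 2))) := measurePreserving_eval _ j
        rw [hS j (Finset.mem_compl.mp hj)] at hmp
        refine le_trans (le_of_eq ?_) hone
        have hms : MeasurableSet {x : ℝ | 48 * L * σ ^ 2 < x ^ 2} :=
          measurableSet_lt (by fun_prop) (by fun_prop)
        exact hmp.measure_preimage hms.nullMeasurableSet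
    _ = (Sᶜ.card : ENNReal) * ENNReal.ofReal (2 * Real.exp (-(18 * L))) := by simp
    _ ≤ (d : ENNReal) * ENNReal.ofReal (2 * Real.exp (-(18 * L))) := by
        gcongr
        simpa using Finset.card_le_univ (Sᶜ)
    _ = _ := by
        rw [← ENNReal.ofReal_natCast, ← ENNReal.ofReal_mul (by positivity)]
        congr 1; ring

lemma aux_mono {x y A : ℝ} (hx : 0 < x) (hxy : x ≤ y) (hA : 0 ≤ A) :
    x * Real.log (1 + A / x) ≤ y * Real.log (1 + A / y) := by
  have hy : 0 < y := hx.trans_le hxy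
  have hAx : 0 ≤ A / x := by positivity
  have hb := rpow_one_add_le_one_add_mul_self (s := A / x) (by linarith) (p := x / y)
    (by positivity) ((div_le_one hy).mpr hxy)
  have e : x / y * (A / x) = A / y := by field_simp
  rw [e] at hb
  have h2 := Real.log_le_log (by positivity) hb
  rw [Real.log_rpow (by positivity)] at h2
  have h3 : y * (x / y * Real.log (1 + A / x)) ≤ y * Real.log (1 + A / y) := by gcongr
  have e2 : y * (x / y * Real.log (1 + A / x)) = x * Real.log (1 + A / x) := by field_simp
  linarith

lemma aux_log_three : (1 : ℝ) ≤ Real.log 3 := by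
  rw [Real.le_log_iff_exp_le (by norm_num)]
  linarith [Real.exp_one_lt_d9]

lemma aux_eventually : ∃ d0 : ℕ, 3 ≤ d0 ∧ ∀ d : ℕ, d0 ≤ d →
    ((5 / 4 : ℝ) ^ d / (2 : ℝ) ^ ((d : ℝ) / 3) ≤ 1 / (d : ℝ) ^ 5 ∧
    2 ^ d / Real.exp (3 / 2 * d) ≤ 1 / (d : ℝ) ^ 5 ∧
    Real.sqrt ((d : ℝ) * Real.log d / 2) ≤ d / 24 - 3 / 8 ∧
    4 * Real.log d ^ 4 ≤ d) := by
  have key : ∀ r : ℝ, 0 ≤ r → r < 1 → ∀ᶠ d : ℕ in Filter.atTop, r ^ d ≤ 1 / (d : ℝ) ^ 5 := by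
    intro r h0 h1
    have ht := tendsto_pow_const_mul_const_pow_of_abs_lt_one 5 (r := r) (by rwa [abs_of_nonneg h0])
    filter_upwards [ht.eventually (gt_mem_nhds (show (0 : ℝ) < 1 by norm_num)),
      Filter.eventually_ge_atTop 1] with d hd hd1
    have : (0 : ℝ) < d := by exact_mod_cast hd1
    rw [le_div_iff₀ (by positivity)]
    linarith
  have ha : ∀ᶠ d : ℕ in Filter.atTop,
      (5 / 4 : ℝ) ^ d / (2 : ℝ) ^ ((d : ℝ) / 3) ≤ 1 / (d : ℝ) ^ 5 := by
    have hp : (5 / 4 : ℝ) < (2 : ℝ) ^ ((1 : ℝ) / 3) := by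
      rw [Real.lt_rpow_iff_log_lt (by norm_num) (by norm_num)]
      have := Real.log_lt_log (by norm_num) (show (5 / 4 : ℝ) ^ 3 < 2 by norm_num)
      rw [Real.log_pow] at this
      push_cast at this
      linarith
    filter_upwards [key ((5 / 4) / (2 : ℝ) ^ ((1 : ℝ) / 3)) (by positivity)
      ((div_lt_one (by positivity)).mpr hp)] with d hd
    rw [div_pow, ← Real.rpow_natCast ((2 : ℝ) ^ ((1 : ℝ) / 3)), ← Real.rpow_mul (by norm_num)] at hd
    rwa [show (d : ℝ) / 3 = 1 / 3 * d by ring]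
  have hb : ∀ᶠ d : ℕ in Filter.atTop, 2 ^ d / Real.exp (3 / 2 * d) ≤ 1 / (d : ℝ) ^ 5 := by
    have hp : (2 : ℝ) < Real.exp (3 / 2) := by
      linarith [Real.add_one_lt_exp (show (3 / 2 : ℝ) ≠ 0 by norm_num)]
    filter_upwards [key (2 / Real.exp (3 / 2)) (by positivity)
      ((div_lt_one (by positivity)).mpr hp)] with d hd
    rwa [div_pow, ← Real.exp_nat_mul, mul_comm] at hd
  have hc : ∀ᶠ d : ℕ in Filter.atTop, Real.sqrt ((d : ℝ) * Real.log d / 2) ≤ d / 24 - 3 / 8 := by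
    have h := (Real.isLittleO_log_id_atTop.comp_tendsto tendsto_natCast_atTop_atTop).bound
      (show (0 : ℝ) < 1 / 2000 by norm_num)
    filter_upwards [h, Filter.eventually_ge_atTop 300] with d hd hd1
    have hd1' : (300 : ℝ) ≤ d := by exact_mod_cast hd1
    simp only [Function.comp, id, Real.norm_eq_abs] at hd
    rw [abs_of_nonneg (show (0 : ℝ) ≤ d by positivity)] at hd
    have hd2 := le_trans (le_abs_self _) hd
    apply Real.sqrt_le_iff.mpr
    constructor
    · linarith
    · have e1 : (d : ℝ) * Real.log d / 2 ≤ d * (1 / 2000 * d) / 2 := by gcongr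
      have e2 : ((d : ℝ) / 25) ^ 2 ≤ (d / 24 - 3 / 8) ^ 2 := by
        apply pow_le_pow_left₀ (by positivity); linarith
      nlinarith
  have hd : ∀ᶠ d : ℕ in Filter.atTop, 4 * Real.log (d : ℝ) ^ 4 ≤ d := by
    have h := ((Real.isLittleO_pow_log_id_atTop (n := 4)).comp_tendsto tendsto_natCast_atTop_atTop).bound
      (show (0 : ℝ) < 1 / 4 by norm_num)
    filter_upwards [h] with d hd
    simp only [Function.comp, id, Real.norm_eq_abs] at hd
    rw [abs_of_nonneg (show (0 : ℝ) ≤ d by positivity)] at hd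
    have hd2 := le_trans (le_abs_self _) hd
    linarith
  obtain ⟨N, hN⟩ := Filter.eventually_atTop.mp (ha.and (hb.and (hc.and hd)))
  exact ⟨max 3 N, le_max_left _ _, fun d hd => hN d (le_of_max_le_right hd)⟩

lemma aux_tail_num {d : ℕ} {θ : Fin d → ℝ} {σ : ℝ} (hσ : 0 < σ) (S : Finset (Fin d))
    (hS : ∀ j, j ∉ S → θ j = 0) (hd3 : 3 ≤ d) (hd4 : 4 * Real.log d ^ 4 ≤ d)
    (k : ℕ) (hk : 1 ≤ k) (hkr : 2 * (k : ℝ) ^ 2 ≤ d * Real.log d) (L : ℝ)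
    (hL : L = Real.log (1 + (d : ℝ) * Real.log d / (k : ℝ) ^ 2)) :
    gaussMeasure d θ σ {y | (64 / 3 * (k : ℝ) ^ 2 * L / Real.log d) * σ ^ 2
        < ∑ j ∈ Sᶜ, if 48 * L * σ ^ 2 < y j ^ 2 then y j ^ 2 else 0}
      ≤ ENNReal.ofReal (2 / (d : ℝ) ^ 6) := by
  have hd3' : (3 : ℝ) ≤ d := by exact_mod_cast hd3
  have hd0 : (0 : ℝ) < d := by linarith
  have hk' : (1 : ℝ) ≤ k := by exact_mod_cast hk
  have hk0 : (0 : ℝ) < k := by linarith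
  have hl1 : 1 ≤ Real.log d := aux_log_three.trans (Real.log_le_log (by norm_num) hd3')
  set l := Real.log d with hl
  set A := (d : ℝ) * l with hA
  have hA0 : 0 < A := by positivity
  set q := (k : ℝ) ^ 2 / A with hq
  have hq0 : 0 < q := by positivity
  have hq2 : q ≤ 1 / 2 := by rw [hq, div_le_iff₀ hA0]; linarith
  have hL1 : 1 ≤ L := by
    rw [hL]
    refine aux_log_three.trans (Real.log_le_log (by norm_num) ?_)
    have : 2 ≤ A / (k : ℝ) ^ 2 := by rw [le_div_iff₀ (by positivity)]; exact hkr
    linarith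
  have hE : Real.exp (-L) ≤ q := by
    rw [Real.exp_neg, hL, Real.exp_log (by positivity), hq,
      ← inv_div A ((k : ℝ) ^ 2)]
    exact inv_anti₀ (by positivity) (by linarith)
  have hEn : ∀ n : ℕ, Real.exp (-(n * L)) ≤ q ^ n := by
    intro n
    rw [show -(n * L) = n * (-L) by ring, Real.exp_nat_mul]
    gcongr
  have hdq : (d : ℝ) * q = k ^ 2 / l := by rw [hq, hA]; field_simp
  by_cases hc : (k : ℝ) ^ 4 < d
  · refine (aux_tail_union hσ S hS L _ (by positivity)).trans (ENNReal.ofReal_le_ofReal ?_)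
    have h18 : Real.exp (-(18 * L)) ≤ q ^ 18 := by exact_mod_cast hEn 18
    have hqq : q ^ 2 ≤ 1 / d := by
      rw [hq, div_pow, div_le_div_iff₀ (by positivity) hd0, hA]
      calc ((k : ℝ) ^ 2) ^ 2 * d = (k : ℝ) ^ 4 * d := by ring
        _ ≤ (d : ℝ) * d := by gcongr
        _ ≤ 1 * (d * l) ^ 2 := by
          have : (1 : ℝ) ≤ l ^ 2 := by nlinarith
          rw [mul_pow]; nlinarith [mul_pos hd0 hd0]
    calc 2 * (d : ℝ) * Real.exp (-(18 * L)) ≤ 2 * d * q ^ 18 := by gcongr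
      _ = 2 * d * (q ^ 2) ^ 9 := by ring
      _ ≤ 2 * d * (1 / d) ^ 9 := by gcongr
      _ = 2 / (d : ℝ) ^ 8 := by field_simp
      _ ≤ 2 / (d : ℝ) ^ 6 := by
        gcongr
        · linarith
        · norm_num
  · have hc' : (d : ℝ) ≤ k ^ 4 := not_lt.mp hc
    refine (aux_tail hσ S hS L _).trans (ENNReal.ofReal_le_ofReal ?_)
    have h6 : Real.exp (-(6 * L)) ≤ q ^ 6 := by exact_mod_cast hEn 6
    have hk2 : 2 * l ^ 2 ≤ (k : ℝ) ^ 2 := by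
      apply le_of_sq_le_sq _ (by positivity)
      nlinarith
    have hkl : 2 * l ≤ d * q := by
      rw [hdq, le_div_iff₀ (by linarith)]; nlinarith
    have hv : 16 / 3 * (d * q) ≤ 64 / 3 * (k : ℝ) ^ 2 * L / l / 4 := by
      have : 64 / 3 * (k : ℝ) ^ 2 * L / l / 4 = 16 / 3 * (d * q) * L := by rw [hdq]; ring
      rw [this]
      have : 0 ≤ 16 / 3 * (d * q) := by positivity
      nlinarith
    have h5 : q ^ 5 ≤ (1 / 2) ^ 5 := by gcongr
    have hq6 : 2 * d * q ^ 6 ≤ 1 / 16 * (d * q) := by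
      have : 0 ≤ 2 * (d * q) := by positivity
      calc 2 * d * q ^ 6 = 2 * (d * q) * q ^ 5 := by ring
        _ ≤ 2 * (d * q) * (1 / 2) ^ 5 := by gcongr
        _ = _ := by ring
    have h7 : 2 * (d : ℝ) * Real.exp (-(6 * L)) ≤ 2 * d * q ^ 6 := by gcongr
    calc Real.exp (2 * d * Real.exp (-(6 * L)) - 64 / 3 * (k : ℝ) ^ 2 * L / l / 4)
        ≤ Real.exp (-((6 : ℕ) * l)) := by
          apply Real.exp_le_exp.mpr; push_cast; linarith
      _ = 1 / (d : ℝ) ^ 6 := by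
          rw [Real.exp_neg, Real.exp_nat_mul, hl, Real.exp_log hd0, one_div]
      _ ≤ 2 / (d : ℝ) ^ 6 := by gcongr; norm_num

/-- Unified threshold (negative beyond the elbow). -/
noncomputable def auxThr (d : ℕ) (α : ℝ) (k : ℕ) (y : Fin d → ℝ) : ℝ :=
  if (k : ℝ) ≤ Real.sqrt ((d : ℝ) * Real.log d / 2) then
    α * (sigmahat d y) ^ 2 * Real.log (1 + (d : ℝ) * Real.log d / (k : ℝ) ^ 2) else -1

/-- Selection weights for the difference of two estimators. -/
noncomputable def auxW (d : ℕ) (α : ℝ) (s k : ℕ) (y : Fin d → ℝ) (j : Fin d) : ℝ :=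
  if auxThr d α k y < y j ^ 2 ∧
    y j ^ 2 ≤ α * (sigmahat d y) ^ 2 * Real.log (1 + (d : ℝ) * Real.log d / (s : ℝ) ^ 2)
  then 1 else 0

lemma auxThr_meas (d : ℕ) (α : ℝ) (k : ℕ) : Measurable (auxThr d α k) := by
  have := aux_sigmahat_meas d
  unfold auxThr
  split_ifs <;> fun_prop

lemma auxW_meas (d : ℕ) (α : ℝ) (s k : ℕ) (j : Fin d) : Measurable fun y => auxW d α s k y j := by
  have h1 := aux_sigmahat_meas d
  have h2 := auxThr_meas d α k
  unfold auxW
  refine Measurable.ite ?_ measurable_const measurable_const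
  have m1 : MeasurableSet {y : Fin d → ℝ | auxThr d α k y < y j ^ 2} :=
    measurableSet_lt h2 (by fun_prop)
  have m2 : MeasurableSet {y : Fin d → ℝ | y j ^ 2 ≤ α * (sigmahat d y) ^ 2 *
      Real.log (1 + (d : ℝ) * Real.log d / (s : ℝ) ^ 2)} :=
    measurableSet_le (by fun_prop) (by fun_prop)
  exact m1.inter m2

lemma auxW_inv (d : ℕ) (α : ℝ) (s k : ℕ) (y y' : Fin d → ℝ) (h : ∀ j, y j ^ 2 = y' j ^ 2) :
    auxW d α s k y = auxW d α s k y' := by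
  funext j
  unfold auxW auxThr
  rw [aux_sigmahat_inv y y' h, h j]

lemma aux_Lhat_eq (d : ℕ) (α : ℝ) (k : ℕ) (y : Fin d → ℝ) :
    LhatS' d α k y = ∑ j, if auxThr d α k y < y j ^ 2 then y j else 0 := by
  unfold LhatS' auxThr
  split_ifs with h
  · rfl
  · refine Finset.sum_congr rfl fun j _ => ?_
    rw [if_pos (by nlinarith [sq_nonneg (y j)])]

set_option maxHeartbeats 1000000 in
lemma aux_det {d : ℕ} {σ α : ℝ} (hα : 48 < α) (hσ : 0 < σ) (S : Finset (Fin d)) (s : ℕ)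
    (hScard : S.card ≤ s) (hd3 : 3 ≤ d) (hs1 : 1 ≤ s)
    (hsr : (s : ℝ) ≤ Real.sqrt ((d : ℝ) * Real.log d / 2)) (y : Fin d → ℝ)
    (h0 : σ ≤ sigmahat d y) (h1 : ∑ j ∈ Sᶜ, y j ^ 2 ≤ 4 * σ ^ 2 * d)
    (k : ℕ) (hk : s < k) (L : ℝ) (hL : L = Real.log (1 + (d : ℝ) * Real.log d / (k : ℝ) ^ 2))
    (h2 : 2 * (k : ℝ) ^ 2 ≤ d * Real.log d →
      ∑ j ∈ Sᶜ, (if 48 * L * σ ^ 2 < y j ^ 2 then y j ^ 2 else 0)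
        ≤ (64 / 3 * (k : ℝ) ^ 2 * L / Real.log d) * σ ^ 2)
    (h3 : ¬ (16 * σ * (k * Real.sqrt L) < |∑ j ∈ Sᶜ, auxW d α s k y j * y j| ∧
      ∑ j ∈ Sᶜ, (auxW d α s k y j * y j) ^ 2 ≤ (64 / 3 * (k : ℝ) ^ 2 * L / Real.log d) * σ ^ 2)) :
    |LhatS' d α s y - LhatS' d α k y|
      ≤ omegaS' d (16 / 9 * (Real.sqrt 12 + 2 * Real.sqrt α) ^ 2) k y := by
  have hd3' : (3 : ℝ) ≤ d := by exact_mod_cast hd3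
  have hd0 : (0 : ℝ) < d := by linarith
  have hs1' : (1 : ℝ) ≤ s := by exact_mod_cast hs1
  have hs0 : (0 : ℝ) < s := by linarith
  have hk' : (s : ℝ) < k := by exact_mod_cast hk
  have hk0 : (0 : ℝ) < k := by linarith
  have hl1 : 1 ≤ Real.log d := aux_log_three.trans (Real.log_le_log (by norm_num) hd3')
  set l := Real.log d with hl
  set A := (d : ℝ) * l with hA
  have hA0 : 0 < A := by positivity
  set Ls := Real.log (1 + A / (s : ℝ) ^ 2) with hLs
  have hLs0 : 0 < Ls := Real.log_pos (by have : 0 < A / (s : ℝ) ^ 2 := by positivity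
                                         linarith)
  have hL0 : 0 < L := by
    rw [hL]; exact Real.log_pos (by have : 0 < A / (k : ℝ) ^ 2 := by positivity
                                    linarith)
  have hLLs : L ≤ Ls := by
    rw [hL]; apply Real.log_le_log (by positivity); gcongr
  have hmono : (s : ℝ) ^ 2 * Ls ≤ (k : ℝ) ^ 2 * L := by
    rw [hL]; exact aux_mono (by positivity) (by gcongr) hA0.le
  have hmono' : (s : ℝ) * √Ls ≤ k * √L := by
    have := Real.sqrt_le_sqrt hmono
    rwa [Real.sqrt_mul (by positivity), Real.sqrt_mul (by positivity), Real.sqrt_sq hs0.le,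
      Real.sqrt_sq hk0.le] at this
  set sh := sigmahat d y with hsh
  have hsh0 : 0 < sh := hσ.trans_le h0
  have hα0 : 0 < α := by linarith
  have hthr_s : auxThr d α s y = α * sh ^ 2 * Ls := by
    unfold auxThr; rw [if_pos hsr]
  have hthr_le : auxThr d α k y ≤ α * sh ^ 2 * Ls := by
    unfold auxThr
    split_ifs
    · rw [← hsh, ← hl, ← hA, ← hL]; gcongr
    · have : 0 ≤ α * sh ^ 2 * Ls := by positivity
      linarith
  -- the difference
  have hdiff : LhatS' d α s y - LhatS' d α k y = - ∑ j, auxW d α s k y j * y j := by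
    rw [aux_Lhat_eq, aux_Lhat_eq, ← Finset.sum_sub_distrib, ← Finset.sum_neg_distrib]
    refine Finset.sum_congr rfl fun j _ => ?_
    rw [hthr_s]
    unfold auxW
    rw [← hsh, ← hl, ← hA, ← hLs]
    by_cases c1 : α * sh ^ 2 * Ls < y j ^ 2
    · have c2 : auxThr d α k y < y j ^ 2 := lt_of_le_of_lt hthr_le c1
      have c3 : ¬ (y j ^ 2 ≤ α * sh ^ 2 * Ls) := not_le.mpr c1
      simp [c1, c2]
    · have c3 : y j ^ 2 ≤ α * sh ^ 2 * Ls := not_lt.mp c1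
      by_cases c2 : auxThr d α k y < y j ^ 2
      · simp [c1, c2, c3]
      · simp [c1, c2]
  -- signal part
  have hw01 : ∀ j, |auxW d α s k y j * y j| ≤ √α * sh * √Ls := by
    intro j
    unfold auxW
    rw [← hsh, ← hl, ← hA, ← hLs]
    split_ifs with c
    · rw [one_mul]
      apply abs_le_of_sq_le_sq _ (by positivity)
      rw [mul_pow, mul_pow, Real.sq_sqrt hα0.le, Real.sq_sqrt hLs0.le]
      exact c.2
    · simp; positivity
  have hSpart : |∑ j ∈ S, auxW d α s k y j * y j| ≤ √α * sh * (k * √L) := by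
    calc |∑ j ∈ S, auxW d α s k y j * y j| ≤ ∑ j ∈ S, |auxW d α s k y j * y j| :=
          Finset.abs_sum_le_sum_abs _ _
      _ ≤ ∑ j ∈ S, √α * sh * √Ls := Finset.sum_le_sum fun j _ => hw01 j
      _ = S.card * (√α * sh * √Ls) := by simp
      _ ≤ s * (√α * sh * √Ls) := by
          gcongr
      _ = √α * sh * (s * √Ls) := by ring
      _ ≤ √α * sh * (k * √L) := by gcongr
  -- variance part
  have hV : ∑ j ∈ Sᶜ, (auxW d α s k y j * y j) ^ 2 ≤ (64 / 3 * (k : ℝ) ^ 2 * L / l) * σ ^ 2 := by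
    by_cases hkr : (k : ℝ) ≤ Real.sqrt (A / 2)
    · have hk2 : 2 * (k : ℝ) ^ 2 ≤ A := by
        have := (Real.le_sqrt (by positivity) (by positivity)).mp hkr
        linarith
      refine le_trans (Finset.sum_le_sum fun j _ => ?_) (h2 hk2)
      have hthr_k : auxThr d α k y = α * sh ^ 2 * L := by
        unfold auxThr; rw [if_pos hkr, hL]
      unfold auxW
      rw [hthr_k]
      by_cases c : α * sh ^ 2 * L < y j ^ 2
      · have c' : 48 * L * σ ^ 2 < y j ^ 2 := by
          refine lt_of_le_of_lt ?_ c
          calc 48 * L * σ ^ 2 = 48 * σ ^ 2 * L := by ring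
            _ ≤ α * sh ^ 2 * L := by gcongr
        rw [if_pos c']
        split_ifs
        · rw [one_mul]
        · rw [zero_mul, zero_pow two_ne_zero]; positivity
      · rw [if_neg (fun h => c h.1)]
        rw [zero_mul, zero_pow two_ne_zero]; split_ifs <;> positivity
    · have hkr' : A / 2 ≤ (k : ℝ) ^ 2 := by
        have h := (not_le.mp hkr).le
        exact (Real.sqrt_le_left hk0.le).mp h
      have e1 : A / 2 * Real.log (1 + A / (A / 2)) ≤ (k : ℝ) ^ 2 * L := by
        rw [hL]; exact aux_mono (by positivity) hkr' hA0.le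
      have e2 : 1 + A / (A / 2) = 3 := by field_simp; norm_num
      rw [e2] at e1
      have e3 : A / 2 ≤ (k : ℝ) ^ 2 * L := by
        refine le_trans ?_ e1
        have := aux_log_three
        nlinarith
      have e4 : (4 : ℝ) * d ≤ 64 / 3 * (k : ℝ) ^ 2 * L / l := by
        rw [le_div_iff₀ (by linarith)]
        have e5 : 4 * (d : ℝ) * l = 4 * A := by rw [hA]; ring
        rw [e5]
        linarith
      calc ∑ j ∈ Sᶜ, (auxW d α s k y j * y j) ^ 2 ≤ ∑ j ∈ Sᶜ, y j ^ 2 := by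
            refine Finset.sum_le_sum fun j _ => ?_
            unfold auxW
            split_ifs
            · rw [one_mul]
            · rw [zero_mul, zero_pow two_ne_zero]; positivity
        _ ≤ 4 * σ ^ 2 * d := h1
        _ = (4 * d) * σ ^ 2 := by ring
        _ ≤ _ := by gcongr
  have hT : |∑ j ∈ Sᶜ, auxW d α s k y j * y j| ≤ 16 * σ * (k * √L) := by
    by_contra hcon
    exact h3 ⟨not_le.mp hcon, hV⟩
  have hom : omegaS' d (16 / 9 * (Real.sqrt 12 + 2 * Real.sqrt α) ^ 2) k y
      = 4 / 3 * (√12 + 2 * √α) * sh * (k * √L) := by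
    unfold omegaS'
    rw [← hsh, ← hl, ← hA, ← hL]
    rw [show 16 / 9 * (√12 + 2 * √α) ^ 2 * sh ^ 2 * (k : ℝ) ^ 2 * L
      = (4 / 3 * (√12 + 2 * √α) * sh * k) ^ 2 * L by ring]
    rw [Real.sqrt_mul (by positivity), Real.sqrt_sq (by positivity)]
    ring
  have h12 : (3.46 : ℝ) ≤ √12 := Real.le_sqrt_of_sq_le (by norm_num)
  have h48 : (6.92 : ℝ) ≤ √α := Real.le_sqrt_of_sq_le (by norm_num; linarith)
  rw [hom, hdiff, abs_neg, ← Finset.sum_add_sum_compl S]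
  have hR : 0 ≤ k * √L := by positivity
  have hT2 : 16 * σ * (k * √L) ≤ 16 * sh * (k * √L) := by gcongr
  calc _ ≤ |∑ j ∈ S, auxW d α s k y j * y j| + |∑ j ∈ Sᶜ, auxW d α s k y j * y j| := abs_add_le _ _
    _ ≤ √α * sh * (k * √L) + 16 * sh * (k * √L) := add_le_add hSpart (hT.trans hT2)
    _ = (√α + 16) * (sh * (k * √L)) := by ring
    _ ≤ (4 / 3 * (√12 + 2 * √α)) * (sh * (k * √L)) := by
        gcongr
        linarith
    _ = _ := by ring

/-- Lemma 2 (ii): with `β = (16/9)(√12 + 2√α)²` and `α > 48`, for every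
`s ≤ √(d log d / 2)`, `P_θ(ŝ' > s) ≤ c d⁻⁵` uniformly over `Θ_s`. -/
theorem shat'_overshoot_probability :
    ∀ α : ℝ, 48 < α → ∃ c : ℝ, 0 < c ∧ ∃ d0 : ℕ, 3 ≤ d0 ∧
      ∀ d : ℕ, d0 ≤ d → ∀ σ : ℝ, 0 < σ →
        ∀ s : ℕ, 1 ≤ s → (s : ℝ) ≤ Real.sqrt ((d : ℝ) * Real.log d / 2) →
          ∀ θ ∈ Theta d s,
            gaussMeasure d θ σ
                {y | s < shat' d α (16 / 9 * (Real.sqrt 12 + 2 * Real.sqrt α) ^ 2) y}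
              ≤ ENNReal.ofReal (c / (d : ℝ) ^ 5) := by
  intro α hα
  obtain ⟨d0, hd03, hd0⟩ := aux_eventually
  refine ⟨6, by norm_num, d0, hd03, ?_⟩
  intro d hd σ hσ s hs1 hsr θ hθ
  obtain ⟨ha, hb, hc, hlog⟩ := hd0 d hd
  have hd3 : 3 ≤ d := hd03.trans hd
  have hd3' : (3 : ℝ) ≤ d := by exact_mod_cast hd3
  have hdpos : (0 : ℝ) < d := by linarith
  have hl1 : 1 ≤ Real.log d := aux_log_three.trans (Real.log_le_log (by norm_num) hd3')
  classical
  set S : Finset (Fin d) := Finset.univ.filter fun j => θ j ≠ 0 with hSdef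
  have hS : ∀ j, j ∉ S → θ j = 0 := by
    intro j hj
    by_contra h
    exact hj (by simp [hSdef, h])
  have hScard : S.card ≤ s := by
    have h : {j | θ j ≠ 0}.ncard ≤ s := hθ
    rwa [show {j | θ j ≠ 0} = (S : Set (Fin d)) by ext j; simp [hSdef], Set.ncard_coe_finset] at h
  set μ := gaussMeasure d θ σ with hμ
  set LL : ℕ → ℝ := fun k => Real.log (1 + (d : ℝ) * Real.log d / (k : ℝ) ^ 2) with hLL
  set B0 : Set (Fin d → ℝ) := {y | (d : ℝ) / 3 ≤
    ((Sᶜ.filter fun j => y j ^ 2 < 4 * σ ^ 2 / 81).card : ℝ)} with hB0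
  set B1 : Set (Fin d → ℝ) := {y | 4 * σ ^ 2 * d < ∑ j ∈ Sᶜ, y j ^ 2} with hB1
  set Bw : ℕ → Set (Fin d → ℝ) := fun k => {y | 2 * (k : ℝ) ^ 2 ≤ d * Real.log d ∧
    (64 / 3 * (k : ℝ) ^ 2 * LL k / Real.log d) * σ ^ 2
      < ∑ j ∈ Sᶜ, if 48 * LL k * σ ^ 2 < y j ^ 2 then y j ^ 2 else 0} with hBw
  set C : ℕ → Set (Fin d → ℝ) := fun k => {y |
    16 * σ * (k * Real.sqrt (LL k)) < |∑ j ∈ Sᶜ, auxW d α s k y j * y j| ∧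
      ∑ j ∈ Sᶜ, (auxW d α s k y j * y j) ^ 2
        ≤ (64 / 3 * (k : ℝ) ^ 2 * LL k / Real.log d) * σ ^ 2} with hC
  have hsub : {y | s < shat' d α (16 / 9 * (Real.sqrt 12 + 2 * Real.sqrt α) ^ 2) y}
      ⊆ (B0 ∪ B1) ∪ ⋃ k ∈ Finset.Icc 1 d, (Bw k ∪ C k) := by
    intro y hy
    by_contra hcon
    simp only [Set.mem_union, Set.mem_iUnion, not_or, not_exists] at hcon
    obtain ⟨⟨n0, n1⟩, n2⟩ := hcon
    have g0 : σ ≤ sigmahat d y := by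
      by_contra h
      exact n0 (aux_sigmahat_lt hσ S s hScard (by omega) (hsr.trans hc) y (not_le.mp h))
    have g1 : ∑ j ∈ Sᶜ, y j ^ 2 ≤ 4 * σ ^ 2 * d := not_lt.mp n1
    have hle : shat' d α (16 / 9 * (Real.sqrt 12 + 2 * Real.sqrt α) ^ 2) y ≤ s := by
      apply Nat.sInf_le
      left
      refine ⟨hs1, Nat.le_floor hsr, ?_⟩
      intro k hk hkd
      obtain ⟨m1, m2⟩ := n2 k (Finset.mem_Icc.mpr ⟨by omega, hkd⟩)
      exact aux_det hα hσ S s hScard hd3 hs1 hsr y g0 g1 k hk (LL k) rfl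
        (fun hk2 => not_lt.mp fun h => m1 ⟨hk2, h⟩) m2
    have hy' : s < shat' d α (16 / 9 * (Real.sqrt 12 + 2 * Real.sqrt α) ^ 2) y := hy
    omega
  have b0 : μ B0 ≤ ENNReal.ofReal (1 / (d : ℝ) ^ 5) :=
    (aux_count hσ S hS).trans (ENNReal.ofReal_le_ofReal ha)
  have b1 : μ B1 ≤ ENNReal.ofReal (1 / (d : ℝ) ^ 5) :=
    (aux_chi hσ S hS).trans (ENNReal.ofReal_le_ofReal hb)
  have bw : ∀ k ∈ Finset.Icc 1 d, μ (Bw k) ≤ ENNReal.ofReal (2 / (d : ℝ) ^ 6) := by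
    intro k hk
    have hk1 := (Finset.mem_Icc.mp hk).1
    by_cases hk2 : 2 * (k : ℝ) ^ 2 ≤ d * Real.log d
    · refine (measure_mono ?_).trans (aux_tail_num hσ S hS hd3 hlog k hk1 hk2 (LL k) rfl)
      rintro y ⟨-, hy⟩
      exact hy
    · have : Bw k = ∅ := by
        ext y
        constructor
        · rintro ⟨h, -⟩; exact absurd h hk2
        · intro h; exact absurd h (Set.notMem_empty y)
      rw [this, measure_empty]; exact bot_le
  have bc : ∀ k ∈ Finset.Icc 1 d, μ (C k) ≤ ENNReal.ofReal (2 / (d : ℝ) ^ 6) := by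
    intro k hk
    have hk1 : (1 : ℝ) ≤ k := by exact_mod_cast (Finset.mem_Icc.mp hk).1
    have hk0 : (0 : ℝ) < k := by linarith
    have hLk : 0 < LL k := Real.log_pos (by
      have : 0 < (d : ℝ) * Real.log d / (k : ℝ) ^ 2 := by positivity
      linarith)
    have h := aux_hoeff σ S hS (auxW d α s k) (auxW_meas d α s k) (auxW_inv d α s k)
      (16 * σ * (k * Real.sqrt (LL k))) ((64 / 3 * (k : ℝ) ^ 2 * LL k / Real.log d) * σ ^ 2)
      (by positivity) (by positivity)
    refine h.trans (ENNReal.ofReal_le_ofReal (le_of_eq ?_))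
    have e : (16 * σ * (k * Real.sqrt (LL k))) ^ 2 /
        (2 * ((64 / 3 * (k : ℝ) ^ 2 * LL k / Real.log d) * σ ^ 2)) = (6 : ℕ) * Real.log d := by
      rw [mul_pow, mul_pow, mul_pow, Real.sq_sqrt hLk.le]
      push_cast
      field_simp
      norm_num
    rw [e, Real.exp_neg, Real.exp_nat_mul, Real.exp_log hdpos, div_eq_mul_inv]
  calc μ {y | s < shat' d α (16 / 9 * (Real.sqrt 12 + 2 * Real.sqrt α) ^ 2) y}
      ≤ μ ((B0 ∪ B1) ∪ ⋃ k ∈ Finset.Icc 1 d, (Bw k ∪ C k)) := measure_mono hsub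
    _ ≤ (μ B0 + μ B1) + ∑ k ∈ Finset.Icc 1 d, (μ (Bw k) + μ (C k)) := by
        refine (measure_union_le _ _).trans (add_le_add (measure_union_le _ _) ?_)
        exact (measure_biUnion_finset_le _ _).trans
          (Finset.sum_le_sum fun k _ => measure_union_le _ _)
    _ ≤ (ENNReal.ofReal (1 / (d : ℝ) ^ 5) + ENNReal.ofReal (1 / (d : ℝ) ^ 5)) +
        ∑ k ∈ Finset.Icc 1 d,
          (ENNReal.ofReal (2 / (d : ℝ) ^ 6) + ENNReal.ofReal (2 / (d : ℝ) ^ 6)) := by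
        refine add_le_add (add_le_add b0 b1) (Finset.sum_le_sum fun k hk => ?_)
        exact add_le_add (bw k hk) (bc k hk)
    _ = ENNReal.ofReal (6 / (d : ℝ) ^ 5) := by
        rw [Finset.sum_const, Nat.card_Icc, nsmul_eq_mul, ← ENNReal.ofReal_natCast,
          ← ENNReal.ofReal_add (by positivity) (by positivity),
          ← ENNReal.ofReal_add (by positivity) (by positivity),
          ← ENNReal.ofReal_mul (by positivity),
          ← ENNReal.ofReal_add (by positivity) (by positivity)]
        congr 1
        rw [Nat.add_sub_cancel]
        field_simp
        norm_num
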